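/- arXiv:2010.03372 — 5 statements merged into one kernel-verified Lean document; each statement's English description precedes it below -/
import Mathlib

section
/- Let z ≥ 1 and let C = {c_1, …, c_{z−1}, c*} be a set of z candidates. Let w ∈ ℚ with 0 < w ≤ 1, and let r_1, r_2 : C → {1, …, z} be bijections (the rank functions of the two non-manipulators N_1 and N_2, where N_1's vote is weighted by w). Define the manipulators' votes by the Respective REVERSE rule: manipulator M_j (j = 1, 2) gives candidate c* the score z − 1, and gives any other candidate c the score r_j(c) − 2 if r_j(c) > r_j(c*) and r_j(c) − 1 otherwise. Then for every candidate c ∈ C, the total score w·(z − r_1(c)) + (z − r_2(c)) + s_1(c) + s_2(c) (where s_j(c) is M_j's score for c) is at most the total score of c*; i.e., c* is one of the Borda winners. -/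
/-- Respective REVERSE algorithm makes `c*` a Borda winner when `0 < w ≤ 1`.
Candidates are modeled as `Fin z`, `cstar` is the distinguished candidate `c*`,
`e1, e2` encode the bijective rank functions `r1, r2 : C → {1, …, z}` of the two
non-manipulators (rank of `c` is `(e j c) + 1`), and `s1, s2` are the scores of
the two manipulators constructed by the Respective REVERSE rule. -/
theorem respective_reverse_wins (z : ℕ) (hz : 1 ≤ z) (w : ℚ) (hw0 : 0 < w) (hw1 : w ≤ 1)
    (cstar : Fin z) (e1 e2 : Fin z ≃ Fin z)
    (r1 r2 : Fin z → ℚ)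
    (hr1 : ∀ c, r1 c = ((e1 c : ℕ) : ℚ) + 1)
    (hr2 : ∀ c, r2 c = ((e2 c : ℕ) : ℚ) + 1)
    (s1 s2 : Fin z → ℚ)
    (hs1 : ∀ c, s1 c = if c = cstar then (z : ℚ) - 1
      else if r1 cstar < r1 c then r1 c - 2 else r1 c - 1)
    (hs2 : ∀ c, s2 c = if c = cstar then (z : ℚ) - 1
      else if r2 cstar < r2 c then r2 c - 2 else r2 c - 1) :
    ∀ c : Fin z,
      w * ((z : ℚ) - r1 c) + ((z : ℚ) - r2 c) + s1 c + s2 c ≤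
      w * ((z : ℚ) - r1 cstar) + ((z : ℚ) - r2 cstar) + s1 cstar + s2 cstar := by
  intro c
  have rank_le (e : Fin z ≃ Fin z) (x : Fin z) : ((e x : ℕ) : ℚ) + 1 ≤ z :=
    mod_cast (e x).isLt
  have h1 : r1 c ≤ z := hr1 c ▸ rank_le e1 c
  have h1' : r1 cstar ≤ z := hr1 cstar ▸ rank_le e1 cstar
  have h2' : r2 cstar ≤ z := hr2 cstar ▸ rank_le e2 cstar
  by_cases hc : c = cstar
  · rw [hc]
  · have hs1c : s1 c ≤ r1 c - 1 := by
      rw [hs1, if_neg hc]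
      split_ifs <;> linarith
    have hs2c : s2 c ≤ r2 c - 1 := by
      rw [hs2, if_neg hc]
      split_ifs <;> linarith
    rw [hs1 cstar, hs2 cstar, if_pos rfl, if_pos rfl]
    have hconv : (1 - w) * r1 c + w * r1 cstar ≤ (1 - w) * z + w * z :=
      add_le_add (mul_le_mul_of_nonneg_left h1 (sub_nonneg.2 hw1))
        (mul_le_mul_of_nonneg_left h1' hw0.le)
    linarith
end

section
/- Let w ∈ ℚ with w ≥ 3, let m ≥ 1, and let a_1 ≤ a_2 ≤ ⋯ ≤ a_m be integers with 2 ≤ a_i ≤ 2m for all i and Σ_{i=1}^m a_i = m(m+1). Set z = ⌈(w+2)m⌉ + 1, v1* = w·⌈(w−1)m⌉ + w, v2* = ⌈(w−2)m⌉ + a_1 − 2, and for each 1 ≤ i ≤ m set v1_i = w·(z − i), d_i = v1* + v2* + 2z − a_{m+1−i}, and v2_i = ⌊d_i − v1_i⌋. Suppose there exist bijections t_1, t_2 from the candidate set {c_1, …, c_{z−1}, c*} to {0, 1, …, z−1} such that for every 1 ≤ i ≤ m, v1_i + v2_i + t_1(c_i) + t_2(c_i) ≤ v1* + v2* + t_1(c*)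 + t_2(c*). Then there exist bijections p_1, p_2 : {1, …, m} → {1, …, m} with p_1(j) + p_2(j) = a_j for all j. -/
open Finset in
/-- A finite set of naturals sums to at least `0 + 1 + ⋯ + (#s - 1)`, and the excess is at least the
number of elements of `s` outside this initial segment. -/
theorem sum_range_card_add_card_sdiff_le (s : Finset ℕ) :
    ∑ i ∈ range s.card, i + (s \ range s.card).card ≤ ∑ i ∈ s, i := by
  set r := range s.card with hr
  have hcard : (s \ r).card = (r \ s).card :=
    card_sdiff_comm (by rw [hr, card_range])
  have hlow : (s \ r).card * s.card ≤ ∑ i ∈ s \ r, i := by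
    simpa using card_nsmul_le_sum (s \ r) (fun i => i) s.card
      (fun i hi => by simpa [hr] using (mem_sdiff.1 hi).2)
  have hhigh : ∑ i ∈ r \ s, (i + 1) ≤ (r \ s).card * s.card := by
    simpa using sum_le_card_nsmul (r \ s) (fun i => i + 1) s.card
      (fun i hi => by simpa [hr] using (mem_sdiff.1 hi).1)
  have hs := sum_inter_add_sum_sdiff s r (fun i => i)
  have hr' := sum_inter_add_sum_sdiff r s (fun i => i)
  rw [inter_comm] at hr'
  rw [sum_add_distrib, sum_const, smul_eq_mul, mul_one] at hhigh
  rw [hcard] at hlow ⊢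
  omega

open Finset in
theorem sum_range_le_sum_range_of_injOn {t : ℕ → ℕ} {m : ℕ} (ht : Set.InjOn t (range m)) :
    ∑ i ∈ range m, i ≤ ∑ i ∈ range m, t i := by
  have h := sum_range_card_add_card_sdiff_le ((range m).image t)
  rw [card_image_of_injOn ht, card_range, sum_image ht] at h
  omega

open Finset in
/-- An injection on `{0, …, m - 1}` with the least possible sum of values permutes this set. -/
theorem bijOn_Iio_of_sum_le {t : ℕ → ℕ} {m : ℕ} (ht : Set.InjOn t (range m))
    (hsum : ∑ i ∈ range m, t i ≤ ∑ i ∈ range m, i) :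
    Set.BijOn t (Set.Iio m) (Set.Iio m) := by
  have h := sum_range_card_add_card_sdiff_le ((range m).image t)
  rw [card_image_of_injOn ht, card_range, sum_image ht] at h
  have hsub : (range m).image t ⊆ range m := by
    rw [← sdiff_eq_empty_iff_subset, ← card_eq_zero]
    omega
  have himage : (range m).image t = range m :=
    eq_of_subset_of_card_le hsub (by rw [card_image_of_injOn ht])
  rw [← coe_range]
  refine ⟨fun i hi => hsub (mem_image_of_mem t hi), ht, ?_⟩
  rw [Set.SurjOn, ← coe_image, himage]

theorem bijOn_Icc_reflect_add_one {t : ℕ → ℕ} {m : ℕ} (ht : Set.BijOn t (Set.Iio m) (Set.Iio m)) :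
    Set.BijOn (fun j => t (m - j) + 1) (Set.Icc 1 m) (Set.Icc 1 m) := by
  have hin : Set.BijOn (fun j => m - j) (Set.Icc 1 m) (Set.Iio m) := by
    refine ⟨fun j hj => ?_, fun j hj k hk h => ?_, fun i hi => ⟨m - i, ?_, ?_⟩⟩ <;>
      simp only [Set.mem_Icc, Set.mem_Iio] at * <;> omega
  have hout : Set.BijOn (fun i => i + 1) (Set.Iio m) (Set.Icc 1 m) := by
    refine ⟨fun j hj => ?_, fun j hj k hk h => ?_, fun i hi => ⟨i - 1, ?_, ?_⟩⟩ <;>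
      simp only [Set.mem_Icc, Set.mem_Iio] at * <;> omega
  exact hout.comp (ht.comp hin)


/-- Only-if direction of the reduction for weight `w ≥ 3` (Lemma 4 of the paper).
Candidates are indexed by `{0, …, z−1}`: candidate `c_i` (for `1 ≤ i ≤ m`) is index
`i − 1` and the distinguished candidate `c*` is index `z − 1`. The manipulators' votes
`t1, t2` are bijections from the candidate indices `{0, …, z−1}` onto the scores
`{0, …, z−1}`. If the manipulators can make every `c_i` score at most `c*`'s total,
then the 2NMTS instance `a_1 ≤ ⋯ ≤ a_m` has a solution. -/
theorem weight_ge_three_only_if (w : ℚ) (hw : 3 ≤ w) (m : ℕ) (hm : 1 ≤ m)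
    (a : ℕ → ℤ)
    (hmono : ∀ i j, 1 ≤ i → i ≤ j → j ≤ m → a i ≤ a j)
    (hlb : ∀ i, 1 ≤ i → i ≤ m → 2 ≤ a i)
    (hub : ∀ i, 1 ≤ i → i ≤ m → a i ≤ 2 * (m : ℤ))
    (hsum : ∑ i ∈ Finset.Icc 1 m, a i = (m : ℤ) * ((m : ℤ) + 1))
    (z : ℕ) (hz : (z : ℤ) = ⌈(w + 2) * (m : ℚ)⌉ + 1)
    (v1star v2star : ℚ)
    (hv1s : v1star = w * (⌈(w - 1) * (m : ℚ)⌉ : ℚ) + w)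
    (hv2s : v2star = (⌈(w - 2) * (m : ℚ)⌉ : ℚ) + (a 1 : ℚ) - 2)
    (v1 v2 d : ℕ → ℚ)
    (hv1 : ∀ i, v1 i = w * ((z : ℚ) - (i : ℚ)))
    (hd : ∀ i, d i = v1star + v2star + 2 * (z : ℚ) - (a (m + 1 - i) : ℚ))
    (hv2 : ∀ i, v2 i = (⌊d i - v1 i⌋ : ℚ))
    (t1 t2 : ℕ → ℕ)
    (ht1 : Set.BijOn t1 (Set.Iio z) (Set.Iio z))
    (ht2 : Set.BijOn t2 (Set.Iio z) (Set.Iio z))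
    (hman : ∀ i, 1 ≤ i → i ≤ m →
      v1 i + v2 i + (t1 (i - 1) : ℚ) + (t2 (i - 1) : ℚ) ≤
        v1star + v2star + (t1 (z - 1) : ℚ) + (t2 (z - 1) : ℚ)) :
    ∃ p1 p2 : ℕ → ℕ, Set.BijOn p1 (Set.Icc 1 m) (Set.Icc 1 m) ∧
      Set.BijOn p2 (Set.Icc 1 m) (Set.Icc 1 m) ∧
      ∀ j, 1 ≤ j → j ≤ m → (p1 j : ℤ) + (p2 j : ℤ) = a j := by
  have hmz : m < z := by
    have h := Int.le_ceil ((w + 2) * (m : ℚ))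
    have hle : (m : ℚ) ≤ (w + 2) * m := le_mul_of_one_le_left m.cast_nonneg (by linarith)
    have hceil : (m : ℤ) ≤ ⌈(w + 2) * (m : ℚ)⌉ := by exact_mod_cast hle.trans h
    omega
  have hstar : z - 1 ∈ Set.Iio z := Set.mem_Iio.2 (by omega)
  have hstar1 : t1 (z - 1) < z := ht1.mapsTo hstar
  have hstar2 : t2 (z - 1) < z := ht2.mapsTo hstar
  have hle : ∀ i ∈ Finset.range m, (t1 i : ℤ) + t2 i ≤ a (m - i) - 2 := by
    intro i hi
    have hi := Finset.mem_range.1 hi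
    have h := hman (i + 1) (by omega) (by omega)
    have hfloor := Int.lt_floor_add_one (d (i + 1) - v1 (i + 1))
    have hdi := hd (i + 1)
    rw [hv2] at h
    rw [Nat.add_sub_cancel] at h
    rw [Nat.add_sub_add_right] at hdi
    have hlt : (2 * z - a (m - i) + t1 i + t2 i : ℚ) < t1 (z - 1) + t2 (z - 1) + 1 := by linarith
    have hltZ : 2 * (z : ℤ) - a (m - i) + t1 i + t2 i < t1 (z - 1) + t2 (z - 1) + 1 := by
      exact_mod_cast hlt
    omega
  have hreflect : ∑ i ∈ Finset.range m, (a (m - i) - 2) = 2 * ∑ i ∈ Finset.range m, (i : ℤ) := by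
    have hIcc : ∑ i ∈ Finset.range m, a (m - i) = ∑ i ∈ Finset.Icc 1 m, a i := by
      refine Finset.sum_nbij' (fun i => m - i) (fun i => m - i) ?_ ?_ ?_ ?_ ?_ <;>
        intro i hi <;> simp only [Finset.mem_range, Finset.mem_Icc] at * <;> omega
    have hgauss : (∑ i ∈ Finset.range m, (i : ℤ)) * 2 = m * (m - 1) := by
      have h := Finset.sum_range_id_mul_two m
      zify [hm] at h
      exact h
    rw [Finset.sum_sub_distrib, hIcc, hsum, Finset.sum_const, Finset.card_range, nsmul_eq_mul]
    linarith
  have hinj1 : Set.InjOn t1 (Finset.range m) :=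
    ht1.injOn.mono (by rw [Finset.coe_range]; exact Set.Iio_subset_Iio hmz.le)
  have hinj2 : Set.InjOn t2 (Finset.range m) :=
    ht2.injOn.mono (by rw [Finset.coe_range]; exact Set.Iio_subset_Iio hmz.le)
  have hlow1 := sum_range_le_sum_range_of_injOn hinj1
  have hlow2 := sum_range_le_sum_range_of_injOn hinj2
  have htotal := Finset.sum_le_sum hle
  rw [hreflect, Finset.sum_add_distrib] at htotal
  zify at hlow1 hlow2
  have heq : ∀ i ∈ Finset.range m, (t1 i : ℤ) + t2 i = a (m - i) - 2 := by
    refine (Finset.sum_eq_sum_iff_of_le hle).1 ?_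
    rw [hreflect, Finset.sum_add_distrib]
    linarith
  refine ⟨fun j => t1 (m - j) + 1, fun j => t2 (m - j) + 1,
    bijOn_Icc_reflect_add_one (bijOn_Iio_of_sum_le hinj1 (by zify; linarith)),
    bijOn_Icc_reflect_add_one (bijOn_Iio_of_sum_le hinj2 (by zify; linarith)), ?_⟩
  intro j hj1 hjm
  have h := heq (m - j) (Finset.mem_range.2 (by omega))
  rw [Nat.sub_sub_self hjm] at h
  push_cast
  linarith
end

section
/- Let w ∈ ℚ with w ≥ 3, let m ≥ 1 be an integer, let a_1 ≥ 2 be an integer, and set z = ⌈(w+2)m⌉ + 1. Then for every integer i with m + 1 ≤ i ≤ ⌈(w+2)m⌉, one has w·(z − i) + 3(i − 1) ≤ w·⌈(w−1)m⌉ + ⌈(w−2)m⌉ + w + a_1 + 2z − 4. -/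
/-- Core inequality in the if-direction of the reduction for weight `w ≥ 3`: for every
candidate index `i` with `m + 1 ≤ i ≤ ⌈(w+2)m⌉`, the dominating virtual total score
`w·(z − i) + 3(i − 1)` is at most `F* = w·⌈(w−1)m⌉ + ⌈(w−2)m⌉ + w + a_1 + 2z − 4`. -/
theorem virtual_scores_le_Fstar (w : ℚ) (hw : 3 ≤ w) (m : ℕ) (hm : 1 ≤ m)
    (a1 : ℤ) (ha1 : 2 ≤ a1)
    (z : ℤ) (hz : z = ⌈(w + 2) * (m : ℚ)⌉ + 1) :
    ∀ i : ℤ, (m : ℤ) + 1 ≤ i → i ≤ ⌈(w + 2) * (m : ℚ)⌉ →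
      w * ((z : ℚ) - (i : ℚ)) + 3 * ((i : ℚ) - 1) ≤
        w * (⌈(w - 1) * (m : ℚ)⌉ : ℚ) + (⌈(w - 2) * (m : ℚ)⌉ : ℚ) + w + (a1 : ℚ)
          + 2 * (z : ℚ) - 4 := by
  intro i hi _
  have h1 : ⌈(w + 2) * (m : ℚ)⌉ = ⌈w * (m : ℚ)⌉ + 2 * (m : ℤ) := by
    rw [← Int.ceil_add_intCast]; push_cast; ring_nf
  have h2 : ⌈(w - 1) * (m : ℚ)⌉ = ⌈w * (m : ℚ)⌉ - (m : ℤ) := by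
    rw [← Int.ceil_sub_intCast]; push_cast; ring_nf
  have h3 : ⌈(w - 2) * (m : ℚ)⌉ = ⌈w * (m : ℚ)⌉ - 2 * (m : ℤ) := by
    rw [← Int.ceil_sub_intCast]; push_cast; ring_nf
  have hC : w * (m : ℚ) ≤ (⌈w * (m : ℚ)⌉ : ℚ) := Int.le_ceil _
  have hi' : (m : ℚ) + 1 ≤ (i : ℚ) := by exact_mod_cast hi
  have hm' : (1 : ℚ) ≤ (m : ℚ) := by exact_mod_cast hm
  have ha : (2 : ℚ) ≤ (a1 : ℚ) := by exact_mod_cast ha1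
  rw [hz, h1, h2, h3]
  push_cast
  have hdecr : 0 ≤ (w - 3) * ((i : ℚ) - (m + 1)) :=
    mul_nonneg (by linarith) (by linarith)
  have hwm : 0 ≤ (w - 3) * (m : ℚ) := mul_nonneg (by linarith) (by linarith)
  linarith
end

section
/- Let m ≥ 1, let b : {1, …, m} → ℕ with Σ_{i=1}^m b(i) = m(m−1), and let t_1, t_2 : {1, …, m} → ℕ be injective functions such that t_1(i) + t_2(i) ≤ b(i) for all i. Then t_1(i) + t_2(i) = b(i) for all i, and the images of t_1 and of t_2 are both equal to {0, 1, …, m−1}. -/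
theorem Finset.sum_range_card_le_sum (s : Finset ℕ) :
    ∑ i ∈ Finset.range s.card, i ≤ ∑ i ∈ s, i := by
  induction s using Finset.induction_on_max with
  | empty => simp
  | insert a s hlt ih =>
    have ha : a ∉ s := fun h => (hlt a h).false
    have hcard : s.card ≤ a := by
      simpa using Finset.card_le_card fun x hx => Finset.mem_range.2 (hlt x hx)
    rw [Finset.card_insert_of_notMem ha, Finset.sum_range_succ, Finset.sum_insert ha]
    omega

theorem Finset.eq_range_card_of_sum_le (s : Finset ℕ)
    (h : ∑ i ∈ s, i ≤ ∑ i ∈ Finset.range s.card, i) : s = Finset.range s.card := by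
  induction s using Finset.induction_on_max with
  | empty => simp
  | insert a s hlt ih =>
    have ha : a ∉ s := fun h => (hlt a h).false
    have hcard : s.card ≤ a := by
      simpa using Finset.card_le_card fun x hx => Finset.mem_range.2 (hlt x hx)
    have hmin := s.sum_range_card_le_sum
    rw [Finset.card_insert_of_notMem ha, Finset.sum_range_succ, Finset.sum_insert ha] at h
    rw [Finset.card_insert_of_notMem ha, Finset.range_add_one, ← ih (by omega),
      show a = s.card by omega]

theorem Function.Injective.sum_range_le_sum {m : ℕ} {t : Fin m → ℕ}
    (ht : Function.Injective t) : ∑ i ∈ Finset.range m, i ≤ ∑ i, t i := by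
  simpa [Finset.card_image_of_injective _ ht, Finset.sum_image ht.injOn] using
    (Finset.univ.image t).sum_range_card_le_sum

theorem Function.Injective.range_eq_Iio_of_sum_le {m : ℕ} {t : Fin m → ℕ}
    (ht : Function.Injective t) (h : ∑ i, t i ≤ ∑ i ∈ Finset.range m, i) :
    Set.range t = Set.Iio m := by
  have hcard : (Finset.univ.image t).card = m := by
    simp [Finset.card_image_of_injective _ ht]
  have himage := (Finset.univ.image t).eq_range_card_of_sum_le (by
    rwa [hcard, Finset.sum_image ht.injOn])
  rw [hcard] at himage
  simpa using congrArg (fun s : Finset ℕ => (s : Set ℕ)) himage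

/-- Counting lemma: if `t1, t2 : Fin m → ℕ` are injective score assignments with
`t1 i + t2 i ≤ b i` pointwise and `Σ b i = m(m−1)`, then all the inequalities are
equalities and the images of `t1` and `t2` are both `{0, 1, …, m−1}`. -/
theorem injective_scores_forced (m : ℕ) (hm : 1 ≤ m) (b t1 t2 : Fin m → ℕ)
    (hsum : ∑ i, b i = m * (m - 1))
    (ht1 : Function.Injective t1) (ht2 : Function.Injective t2)
    (hle : ∀ i, t1 i + t2 i ≤ b i) :
    (∀ i, t1 i + t2 i = b i) ∧ Set.range t1 = Set.Iio m ∧ Set.range t2 = Set.Iio m := by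
  have hmin1 := ht1.sum_range_le_sum
  have hmin2 := ht2.sum_range_le_sum
  have hgauss := Finset.sum_range_id_mul_two m
  have hsum_le := Finset.sum_le_sum fun i (_ : i ∈ Finset.univ) => hle i
  rw [Finset.sum_add_distrib] at hsum_le
  refine ⟨fun i => ?_, ht1.range_eq_Iio_of_sum_le (by omega),
    ht2.range_eq_Iio_of_sum_le (by omega)⟩
  refine (Finset.sum_eq_sum_iff_of_le fun i _ => hle i).1 ?_ i (Finset.mem_univ i)
  rw [Finset.sum_add_distrib]
  omega
end

section
/- Let m ≥ 1 and let a_1 ≤ a_2 ≤ ⋯ ≤ a_m be integers with 2 ≤ a_i ≤ 2m for all i and Σ_{i=1}^m a_i = m(m+1). Set z = 7m + 1, v1* = 4m, v2* = m + a_1, and for 1 ≤ i ≤ m set v1_i = 2(z − i) and v2_i = z + 2i − a_{m+1−i} − 2m + a_1 − 1. Suppose there exist bijections t_1, t_2 from the candidate set {c_1, …, c_{z−1}, c*} to {0, 1, …, z−1} such that for every 1 ≤ i ≤ m, v1_i + v2_i + t_1(c_i) + t_2(c_i) ≤ v1* + v2* + t_1(c*) + t_2(c*). Then there exist bijections p_1,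 p_2 : {1, …, m} → {1, …, m} with p_1(j) + p_2(j) = a_j for all j. -/
theorem Finset.sum_range_add_card_sdiff_le_sum (S : Finset ℕ) :
    ∑ x ∈ Finset.range S.card, x + (S \ Finset.range S.card).card ≤ ∑ x ∈ S, x := by
  set n := S.card with hn
  have hcard : (S \ Finset.range n).card = (Finset.range n \ S).card :=
    Finset.card_sdiff_comm (by simp [hn])
  have hS := Finset.sum_inter_add_sum_sdiff S (Finset.range n) (fun x => x)
  have hR := Finset.sum_inter_add_sum_sdiff (Finset.range n) S (fun x => x)
  rw [Finset.inter_comm] at hR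
  have h1 : (S \ Finset.range n).card * n ≤ ∑ x ∈ S \ Finset.range n, x := by
    rw [← smul_eq_mul]
    exact Finset.card_nsmul_le_sum _ _ _ (by simp)
  have h2 : ∑ x ∈ Finset.range n \ S, (x + 1) ≤ (Finset.range n \ S).card * n := by
    rw [← smul_eq_mul]
    exact Finset.sum_le_card_nsmul _ _ _ (by simp +contextual)
  rw [Finset.sum_add_distrib, Finset.sum_const, smul_eq_mul, mul_one, ← hcard] at h2
  omega

/-- Among injective families of `m` naturals, the least possible sum is that of `0, …, m - 1`, and
each value that is not below `m` costs at least one more. -/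
theorem Set.InjOn.le_two_mul_sum {m : ℕ} {f : ℕ → ℕ} (hf : Set.InjOn f (Set.Icc 1 m)) :
    m * (m - 1) + 2 * ((Finset.Icc 1 m).image f \ Finset.range m).card ≤
      2 * ∑ j ∈ Finset.Icc 1 m, f j := by
  have hf' : Set.InjOn f (Finset.Icc 1 m : Finset ℕ) := by simpa using hf
  have hcard : ((Finset.Icc 1 m).image f).card = m := by
    rw [Finset.card_image_of_injOn hf']; simp
  have h := Finset.sum_range_add_card_sdiff_le_sum ((Finset.Icc 1 m).image f)
  rw [hcard, Finset.sum_image hf'] at h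
  have hg := Finset.sum_range_id_mul_two m
  omega

theorem Set.InjOn.bijOn_succ {m : ℕ} {f : ℕ → ℕ} (hf : Set.InjOn f (Set.Icc 1 m))
    (hcard : ((Finset.Icc 1 m).image f \ Finset.range m).card = 0) :
    Set.BijOn (fun j => f j + 1) (Set.Icc 1 m) (Set.Icc 1 m) := by
  rw [Finset.card_eq_zero, Finset.sdiff_eq_empty_iff_subset, Finset.image_subset_iff] at hcard
  have hmaps : Set.MapsTo (fun j => f j + 1) (Set.Icc 1 m) (Set.Icc 1 m) := by
    intro j hj
    have := Finset.mem_range.mp (hcard j (Finset.mem_Icc.mpr hj))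
    exact ⟨by simp, this⟩
  have hinj : Set.InjOn (fun j => f j + 1) (Set.Icc 1 m) :=
    fun i hi j hj h => hf hi hj (Nat.succ_injective h)
  refine ⟨hmaps, hinj, ?_⟩
  rw [← Finset.coe_Icc] at hmaps hinj ⊢
  exact Finset.surjOn_of_injOn_of_card_le _ hmaps hinj le_rfl


/-- Only-if direction of the reduction for weight `w = 2` (Lemma 5 of the paper).
Candidates are indexed by `{0, …, z−1}` with `z = 7m + 1`: candidate `c_i`
(for `1 ≤ i ≤ m`) is index `i − 1` and the distinguished candidate `c*` is index
`z − 1`. The manipulators' votes `t1, t2` are bijections from the candidate indices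
`{0, …, z−1}` onto the scores `{0, …, z−1}`. If the manipulators can make every `c_i`
score at most `c*`'s total, then the 2NMTS instance `a_1 ≤ ⋯ ≤ a_m` has a solution. -/
theorem weight_two_only_if (m : ℕ) (hm : 1 ≤ m)
    (a : ℕ → ℤ)
    (hmono : ∀ i j, 1 ≤ i → i ≤ j → j ≤ m → a i ≤ a j)
    (hlb : ∀ i, 1 ≤ i → i ≤ m → 2 ≤ a i)
    (hub : ∀ i, 1 ≤ i → i ≤ m → a i ≤ 2 * (m : ℤ))
    (hsum : ∑ i ∈ Finset.Icc 1 m, a i = (m : ℤ) * ((m : ℤ) + 1))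
    (z : ℕ) (hz : z = 7 * m + 1)
    (v1star v2star : ℤ)
    (hv1s : v1star = 4 * (m : ℤ)) (hv2s : v2star = (m : ℤ) + a 1)
    (v1 v2 : ℕ → ℤ)
    (hv1 : ∀ i, v1 i = 2 * ((z : ℤ) - (i : ℤ)))
    (hv2 : ∀ i, v2 i = (z : ℤ) + 2 * (i : ℤ) - a (m + 1 - i) - 2 * (m : ℤ) + a 1 - 1)
    (t1 t2 : ℕ → ℕ)
    (ht1 : Set.BijOn t1 (Set.Iio z) (Set.Iio z))
    (ht2 : Set.BijOn t2 (Set.Iio z) (Set.Iio z))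
    (hman : ∀ i, 1 ≤ i → i ≤ m →
      v1 i + v2 i + (t1 (i - 1) : ℤ) + (t2 (i - 1) : ℤ) ≤
        v1star + v2star + (t1 (z - 1) : ℤ) + (t2 (z - 1) : ℤ)) :
    ∃ p1 p2 : ℕ → ℕ, Set.BijOn p1 (Set.Icc 1 m) (Set.Icc 1 m) ∧
      Set.BijOn p2 (Set.Icc 1 m) (Set.Icc 1 m) ∧
      ∀ j, 1 ≤ j → j ≤ m → (p1 j : ℤ) + (p2 j : ℤ) = a j := by
  have hinj : ∀ t : ℕ → ℕ, Set.BijOn t (Set.Iio z) (Set.Iio z) →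
      Set.InjOn (fun j => t (m - j)) (Set.Icc 1 m) := by
    intro t ht i hi j hj h
    simp only [Set.mem_Icc] at hi hj
    have := ht.injOn (Set.mem_Iio.mpr (by omega)) (Set.mem_Iio.mpr (by omega)) h
    omega
  have hle : ∀ j ∈ Finset.Icc 1 m, (t1 (m - j) : ℤ) + t2 (m - j) ≤ a j - 2 := by
    intro j hj
    rw [Finset.mem_Icc] at hj
    have h := hman (m + 1 - j) (by omega) (by omega)
    have e1 : m + 1 - (m + 1 - j) = j := by omega
    have e2 : m + 1 - j - 1 = m - j := by omega
    rw [hv1, hv2, e1, e2] at h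
    have h1 : t1 (z - 1) < z := ht1.mapsTo (Set.mem_Iio.mpr (by omega))
    have h2 : t2 (z - 1) < z := ht2.mapsTo (Set.mem_Iio.mpr (by omega))
    omega
  have hi1 := hinj t1 ht1
  have hi2 := hinj t2 ht2
  have hs1 := hi1.le_two_mul_sum
  have hs2 := hi2.le_two_mul_sum
  have hsum' : ∑ j ∈ Finset.Icc 1 m, (a j - 2) = (m : ℤ) * ((m - 1 : ℕ) : ℤ) := by
    rw [Finset.sum_sub_distrib, hsum]
    push_cast [hm]
    simp
    ring
  have hs := Finset.sum_le_sum hle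
  have hsplit : ∑ j ∈ Finset.Icc 1 m, ((t1 (m - j) : ℤ) + t2 (m - j)) =
      ((∑ j ∈ Finset.Icc 1 m, t1 (m - j) : ℕ) : ℤ) +
        ((∑ j ∈ Finset.Icc 1 m, t2 (m - j) : ℕ) : ℤ) := by
    push_cast
    exact Finset.sum_add_distrib
  rw [← Nat.cast_mul] at hsum'
  have heq := (Finset.sum_eq_sum_iff_of_le hle).mp (by omega)
  refine ⟨_, _, hi1.bijOn_succ (by omega), hi2.bijOn_succ (by omega), fun j hj hjm => ?_⟩
  have := heq j (Finset.mem_Icc.mpr ⟨hj, hjm⟩)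
  push_cast
  linarith
end
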